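/- Let N ∈ ℕ and let C^A_{BC} (A,B,C = 1,…,N) be real constants, antisymmetric in the lower indices, such that the N×N matrices C_A with entries (C_A)^B_C = C^B_{AC} satisfy [C_A, C_B] = Σ_C C^C_{AB} C_C. Let γ = (γ_{AB}) be a real symmetric invertible N×N matrix (inverse γ^{AB}) satisfying γ_{AB} C^B_{CD} + γ_{DB} C^B_{CA} = 0. For k ∈ ℝ^N set C(k) := Σ_A k^A C_A, Y(k) := Σ_{j≥0} (−1)^j C(k)^j/(j+1)!, and on the open set U := {k : Y(k) invertible} define X_A{}^M(k) by Σ_M Y^B_M(k) X_A{}^M(k) = δ^B_A; for smooth f : U → ℝ set X_A[f] := Σ_M X_A{}^M ∂f/∂k^M and X²[f] := Σ_{A,B} γ^{AB} X_A[X_B[f]]. Then the Casimir operator X² commutes with each X_A: for every smooth f : U → ℝ, every A, and every k ∈ U, X_A[X²[f]](k) = X²[X_A[f]](k). -/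

import Mathlib

open Matrix

/-- The first-order differential operator `X_A = Σ_M X_A{}^M ∂/∂k^M` acting on functions. -/
noncomputable def vecFieldOp {N : ℕ} (Xe : (Fin N → ℝ) → Fin N → Fin N → ℝ) (A : Fin N)
    (f : (Fin N → ℝ) → ℝ) (k : Fin N → ℝ) : ℝ :=
  ∑ M, Xe k A M * fderiv ℝ f k (Pi.single M 1)

/-- The Casimir operator `X² = γ^{AB} X_A X_B`. -/
noncomputable def casimirOp {N : ℕ} (γinv : Matrix (Fin N) (Fin N) ℝ)
    (Xe : (Fin N → ℝ) → Fin N → Fin N → ℝ) (f : (Fin N → ℝ) → ℝ) (k : Fin N → ℝ) : ℝ :=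
  ∑ A, ∑ B, γinv A B * vecFieldOp Xe A (vecFieldOp Xe B f) k

section Exponential

open scoped Matrix.Norms.Operator
open NormedSpace

variable {𝔸 : Type*} [NormedRing 𝔸]

lemma upperRow_pow_succ (a b : 𝔸) (n : ℕ) :
    !![a, b; 0, 0] ^ (n + 1) = !![a ^ (n + 1), a ^ n * b; 0, 0] := by
  induction n with
  | zero => simp
  | succ n ih =>
    rw [pow_succ', ih]
    ext i j
    fin_cases i <;> fin_cases j <;> simp [Matrix.mul_apply, pow_succ', mul_assoc]

variable [NormedAlgebra ℝ 𝔸]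

/-- The entire function `(1 - exp (-x)) / x`, realised as an off-diagonal block of the exponential
of a `2 × 2` matrix. -/
noncomputable def oneSubExpNegDiv (x : 𝔸) : 𝔸 :=
  exp !![-x, 1; 0, 0] 0 1

variable [CompleteSpace 𝔸]

instance completeSpace_linftyOp :
    @CompleteSpace (Matrix (Fin 2) (Fin 2) 𝔸)
      Matrix.linftyOpNormedRing.toPseudoMetricSpace.toUniformSpace :=
  inferInstanceAs (CompleteSpace (Fin 2 → Fin 2 → 𝔸))

lemma hasSum_exp_apply (M : Matrix (Fin 2) (Fin 2) 𝔸) (i j : Fin 2) :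
    HasSum (fun n : ℕ => ((n.factorial : ℝ)⁻¹ • M ^ n) i j) (exp M i j) := by
  have h := exp_series_hasSum_exp' (𝕂 := ℝ) M
  exact Pi.hasSum.mp (Pi.hasSum.mp h i) j

lemma hasSum_exp_upperRow (a b : 𝔸) :
    HasSum (fun n : ℕ => ((n + 1).factorial : ℝ)⁻¹ • (a ^ n * b)) (exp !![a, b; 0, 0] 0 1) := by
  have h := hasSum_exp_apply !![a, b; 0, 0] 0 1
  rw [← hasSum_nat_add_iff' 1] at h
  simpa [upperRow_pow_succ] using h

lemma exp_upperRow_apply_one_one (a b : 𝔸) : exp !![a, b; 0, 0] 1 1 = 1 := by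
  have h := hasSum_exp_apply !![a, b; 0, 0] 1 1
  rw [← hasSum_nat_add_iff' 1] at h
  have h0 : HasSum (fun _ : ℕ => (0 : 𝔸)) (exp !![a, b; 0, 0] 1 1 - 1) := by
    simpa [upperRow_pow_succ] using h
  exact sub_eq_zero.mp (h0.unique hasSum_zero)

lemma oneSubExpNegDiv_eq_tsum (x : 𝔸) :
    oneSubExpNegDiv x = ∑' n : ℕ, ((-1 : ℝ) ^ n / (n + 1).factorial) • x ^ n := by
  refine (hasSum_exp_upperRow (-x) 1).tsum_eq.symm.trans (tsum_congr fun n => ?_)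
  have : (-x) ^ n = (-1 : ℝ) ^ n • x ^ n := by
    rw [← neg_one_smul ℝ x, smul_pow]
  rw [mul_one, this, smul_smul, div_eq_inv_mul]

lemma contDiff_oneSubExpNegDiv {n : WithTop ℕ∞} : ContDiff ℝ n (oneSubExpNegDiv : 𝔸 → 𝔸) := by
  have hexp : ContDiff ℝ n (exp : Matrix (Fin 2) (Fin 2) 𝔸 → _) :=
    contDiff_iff_contDiffAt.mpr fun x => (exp_analytic (𝕂 := ℝ) x).contDiffAt
  let entry : Matrix (Fin 2) (Fin 2) 𝔸 →L[ℝ] 𝔸 :=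
    ⟨Matrix.entryLinearMap ℝ 𝔸 0 1, continuous_id.matrix_elem 0 1⟩
  let corner : 𝔸 →L[ℝ] Matrix (Fin 2) (Fin 2) 𝔸 :=
    ⟨Matrix.singleLinearMap ℝ 0 0, continuous_matrix fun i j => by
      fin_cases i <;> fin_cases j <;> simp [Matrix.singleLinearMap, Matrix.single] <;>
        fun_prop⟩
  have hblock : (oneSubExpNegDiv : 𝔸 → 𝔸) =
      fun x => entry (exp (corner (-x) + !![0, 1; 0, 0])) := by
    funext x
    have : corner (-x) + !![0, 1; 0, 0] = !![-x, 1; 0, 0] := by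
      ext i j
      fin_cases i <;> fin_cases j <;> simp [corner]
    rw [this]
    rfl
  rw [hblock]
  exact entry.contDiff.comp (hexp.comp ((corner.contDiff.comp contDiff_neg).add contDiff_const))

/-- The radial derivative of `x ↦ (1 - exp (-x)) / x`. -/
lemma fderiv_oneSubExpNegDiv_self (x : 𝔸) :
    fderiv ℝ oneSubExpNegDiv x x + oneSubExpNegDiv x + x * oneSubExpNegDiv x = 1 := by
  have hscale (t : ℝ) :
      exp (t • !![-x, 1; 0, 0]) 0 1 = t • oneSubExpNegDiv (t • x) := by
    have h1 := hasSum_exp_upperRow (-(t • x)) (1 : 𝔸)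
    have h2 := hasSum_exp_upperRow (-(t • x)) (t • (1 : 𝔸))
    have h3 : t • !![-x, 1; 0, 0] = !![-(t • x), t • (1 : 𝔸); 0, 0] := by simp [Matrix.smul_of]
    rw [h3]
    refine h2.unique ?_
    have h4 : HasSum _ (t • oneSubExpNegDiv (t • x)) := h1.const_smul t
    convert h4 using 2 with n
    rw [mul_smul_comm, smul_comm]
  have hd := hasDerivAt_exp_smul_const' (𝕂 := ℝ) !![-x, 1; 0, 0] (1 : ℝ)
  have hd01 := (hasDerivAt_pi.mp (hasDerivAt_pi.mp hd 0)) 1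
  replace hd01 : HasDerivAt (fun t : ℝ => t • oneSubExpNegDiv (t • x))
      ((!![-x, 1; 0, 0] * exp ((1 : ℝ) • !![-x, 1; 0, 0])) 0 1) 1 :=
    hd01.congr_of_eventuallyEq (.of_forall fun t => (hscale t).symm)
  have he :=
    ((contDiff_oneSubExpNegDiv (𝔸 := 𝔸) (n := 1)).differentiable one_ne_zero).differentiableAt (x := (1 : ℝ) • x)
  have hc := (hasDerivAt_id (1 : ℝ)).smul
    (he.hasFDerivAt.comp_hasDerivAt (1 : ℝ) ((hasDerivAt_id (1 : ℝ)).smul_const x))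

  have := hc.unique hd01
  simp [Matrix.mul_apply] at this
  rw [this, exp_upperRow_apply_one_one, oneSubExpNegDiv]
  abel

end Exponential

section MaurerCartan
variable {E : Type*} [NormedAddCommGroup E] [NormedSpace ℝ E]

/-- The Maurer-Cartan equation for `Y = (1 - exp (-ad)) / ad`, deduced from the radial equation
that `Y` satisfies. -/
lemma maurerCartan_of_radial (L : E →L[ℝ] E →L[ℝ] E)
    (hanti : ∀ v w, L v w = -L w v)
    (hjac : ∀ v w u, L (L v w) u = L v (L w u) - L w (L v u))
    (Y : E → E →L[ℝ] E) (hY : ContDiff ℝ 2 Y)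
    (hrad : ∀ k v, fderiv ℝ Y k k v + Y k v + L k (Y k v) = v) (k v w : E) :
    fderiv ℝ Y k v w - fderiv ℝ Y k w v + L (Y k v) (Y k w) = 0 := by
  have hYd (k : E) : HasFDerivAt Y (fderiv ℝ Y k) k :=
    (hY.differentiable two_ne_zero).differentiableAt.hasFDerivAt
  have hY'd (k : E) : HasFDerivAt (fderiv ℝ Y) (fderiv ℝ (fderiv ℝ Y) k) k :=
    ((hY.fderiv_right (m := 1) (by norm_num)).differentiable one_ne_zero).differentiableAt.hasFDerivAt
  have hsymm (k a b : E) : fderiv ℝ (fderiv ℝ Y) k a b = fderiv ℝ (fderiv ℝ Y) k b a :=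
    (hY.contDiffAt.isSymmSndFDerivAt (by simp)).eq a b
  have hrad' (k v w : E) : fderiv ℝ (fderiv ℝ Y) k k v w =
      -fderiv ℝ Y k v w - fderiv ℝ Y k v w - L v (Y k w) - L k (fderiv ℝ Y k v w) := by
    have h1 : HasFDerivAt (fun k => fderiv ℝ Y k k w + Y k w + L k (Y k w)) _ k :=
      ((((hY'd k).clm_apply (hasFDerivAt_id k)).clm_apply (hasFDerivAt_const w k)).add
      ((hYd k).clm_apply (hasFDerivAt_const w k))).add
      ((L.hasFDerivAt (x := k)).clm_apply ((hYd k).clm_apply (hasFDerivAt_const w k)))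
    have h2 := h1.unique ((hasFDerivAt_const w k).congr_of_eventuallyEq (.of_forall fun x => hrad x w))
    have h3 := congrArg (fun T : E →L[ℝ] E => T v) h2
    simp at h3
    rw [hsymm]
    rw [← sub_eq_zero, ← h3]
    abel
  set G : E → E := fun k => fderiv ℝ Y k v w - fderiv ℝ Y k w v + L (Y k v) (Y k w) with hG
  have hGrad (k : E) : ∃ G' : E →L[ℝ] E, HasFDerivAt G G' k ∧ G' k = -(2 : ℝ) • G k - L k (G k) := by
    refine ⟨_, ((((hY'd k).clm_apply (hasFDerivAt_const v k)).clm_apply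
      (hasFDerivAt_const w k)).sub (((hY'd k).clm_apply (hasFDerivAt_const w k)).clm_apply
      (hasFDerivAt_const v k))).add ((L.hasFDerivAt.comp k ((hYd k).clm_apply
      (hasFDerivAt_const v k))).clm_apply ((hYd k).clm_apply (hasFDerivAt_const w k))), ?_⟩
    have e (u : E) : fderiv ℝ Y k k u = u - Y k u - L k (Y k u) := by
      rw [← sub_eq_zero, ← sub_eq_zero.mpr (hrad k u)]; abel
    simp [hG, hrad', e, hjac, two_smul]
    rw [hanti w (Y k v)]
    abel
  have hflow (t : ℝ) :
      HasDerivAt (fun t : ℝ => t ^ 2 • G (t • k)) (-L k (t ^ 2 • G (t • k))) t := by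
    obtain ⟨G', hG', hGk⟩ := hGrad (t • k)
    have hline : HasDerivAt (fun t : ℝ => t • k) k t := by
      simpa using (hasDerivAt_id t).smul_const k
    have hGt : HasDerivAt (fun t : ℝ => G (t • k)) (G' k) t :=
      HasFDerivAt.comp_hasDerivAt (l := G) (l' := G') (f := fun t => t • k) t hG' hline
    have h : HasDerivAt (fun t : ℝ => t ^ 2 • G (t • k)) _ t := (hasDerivAt_pow 2 t).smul hGt
    convert h using 1
    simp at hGk ⊢
    have : t ^ 2 • G' k = t • (t • G' k) := by rw [smul_smul, sq]
    rw [this, hGk]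
    module
  have h := eq_zero_of_abs_deriv_le_mul_abs_self_of_eq_zero_right
    (f := fun t : ℝ => t ^ 2 • G (t • k)) (K := ‖L k‖) (a := 0) (b := 1)
    (fun t _ => (hflow t).continuousAt.continuousWithinAt)
    (fun t _ => (hflow t).hasDerivWithinAt) (by simp)
    (fun t _ => by rw [norm_neg]; exact (L k).le_opNorm _) 1 (by simp)
  simpa using h

/-- Vector fields dual to a coframe `Y` obeying the Maurer-Cartan equation close under the
Lie bracket. -/
lemma lieBracket_of_maurerCartan (L : E →L[ℝ] E →L[ℝ] E) (Y : E → E →L[ℝ] E)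
    (hMC : ∀ k v w, fderiv ℝ Y k v w - fderiv ℝ Y k w v + L (Y k v) (Y k w) = 0)
    {k a b : E} {V W : E → E} (hYk : DifferentiableAt ℝ Y k)
    (hV : DifferentiableAt ℝ V k) (hW : DifferentiableAt ℝ W k)
    (hYV : ∀ᶠ x in nhds k, Y x (V x) = a) (hYW : ∀ᶠ x in nhds k, Y x (W x) = b) :
    Y k (VectorField.lieBracket ℝ V W k) = L a b := by
  have hVd := (hYk.hasFDerivAt.clm_apply hV.hasFDerivAt).unique
    ((hasFDerivAt_const a k).congr_of_eventuallyEq hYV)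
  have hWd := (hYk.hasFDerivAt.clm_apply hW.hasFDerivAt).unique
    ((hasFDerivAt_const b k).congr_of_eventuallyEq hYW)
  have h1 := congrArg (fun T : E →L[ℝ] E => T (W k)) hVd
  have h2 := congrArg (fun T : E →L[ℝ] E => T (V k)) hWd
  have h3 := hMC k (V k) (W k)
  rw [hYV.self_of_nhds, hYW.self_of_nhds] at h3
  simp at h1 h2
  rw [VectorField.lieBracket, map_sub, eq_neg_of_add_eq_zero_left h1,
    eq_neg_of_add_eq_zero_left h2, ← sub_eq_zero, ← neg_eq_zero, ← h3]
  abel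

end MaurerCartan

section Commutator

open scoped ContDiff

variable {N : ℕ} {Xe : (Fin N → ℝ) → Fin N → Fin N → ℝ} {U : Set (Fin N → ℝ)}

lemma vecFieldOp_eq_fderiv (A : Fin N) (f : (Fin N → ℝ) → ℝ) (k : Fin N → ℝ) :
    vecFieldOp Xe A f k = fderiv ℝ f k (Xe k A) := by
  conv_rhs => rw [pi_eq_sum_univ' (Xe k A), map_sum]
  simp only [map_smul, smul_eq_mul]
  refine Finset.sum_congr rfl fun M _ => ?_
  congr 2

lemma contDiffOn_vecFieldOp (hU : IsOpen U) {A : Fin N} {f : (Fin N → ℝ) → ℝ}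
    (hX : ContDiffOn ℝ ∞ (fun k => Xe k A) U) (hf : ContDiffOn ℝ ∞ f U) :
    ContDiffOn ℝ ∞ (vecFieldOp Xe A f) U := by
  rw [show vecFieldOp Xe A f = fun k => fderiv ℝ f k (Xe k A) from
    funext (vecFieldOp_eq_fderiv A f)]
  exact (hf.fderiv_of_isOpen hU (by simp)).clm_apply hX

lemma vecFieldOp_congr (hU : IsOpen U) (A : Fin N) {f g : (Fin N → ℝ) → ℝ} (h : Set.EqOn f g U) :
    Set.EqOn (vecFieldOp Xe A f) (vecFieldOp Xe A g) U := fun k hk => by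
  rw [vecFieldOp_eq_fderiv, vecFieldOp_eq_fderiv,
    (Filter.eventuallyEq_of_mem (hU.mem_nhds hk) h).fderiv_eq]

lemma vecFieldOp_add (A : Fin N) {f g : (Fin N → ℝ) → ℝ} {k : Fin N → ℝ}
    (hf : DifferentiableAt ℝ f k) (hg : DifferentiableAt ℝ g k) :
    vecFieldOp Xe A (fun x => f x + g x) k = vecFieldOp Xe A f k + vecFieldOp Xe A g k := by
  simp only [vecFieldOp_eq_fderiv]
  rw [fderiv_fun_add hf hg, _root_.add_apply]

lemma vecFieldOp_sum (A : Fin N) {ι : Type*} [Fintype ι] (c : ι → ℝ)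
    {f : ι → (Fin N → ℝ) → ℝ} {k : Fin N → ℝ} (hf : ∀ i, DifferentiableAt ℝ (f i) k) :
    vecFieldOp Xe A (fun x => ∑ i, c i * f i x) k = ∑ i, c i * vecFieldOp Xe A (f i) k := by
  simp only [vecFieldOp_eq_fderiv]
  rw [fderiv_fun_sum fun i _ => (hf i).const_mul (c i), _root_.sum_apply]
  refine Finset.sum_congr rfl fun i _ => ?_
  rw [fderiv_const_mul (hf i)]
  rfl

/-- Invariance of `g` under the structure constants `c` of the frame makes the second-order
operator with symbol `g` commute with the frame. -/
lemma vecFieldOp_casimirOp_comm (hU : IsOpen U) (hX : ∀ A, ContDiffOn ℝ ∞ (fun k => Xe k A) U)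
    (c : Fin N → Fin N → Fin N → ℝ) (g : Matrix (Fin N) (Fin N) ℝ)
    (hcomm : ∀ f : (Fin N → ℝ) → ℝ, ContDiffOn ℝ ∞ f U → ∀ A B, ∀ k ∈ U,
      vecFieldOp Xe A (vecFieldOp Xe B f) k =
        vecFieldOp Xe B (vecFieldOp Xe A f) k + ∑ D, c D A B * vecFieldOp Xe D f k)
    (hg : ∀ A B D, ∑ F, c B A F * g F D + ∑ F, g B F * c D A F = 0)
    {f : (Fin N → ℝ) → ℝ} (hf : ContDiffOn ℝ ∞ f U) (A : Fin N) {k : Fin N → ℝ} (hk : k ∈ U) :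
    vecFieldOp Xe A (casimirOp g Xe f) k = casimirOp g Xe (vecFieldOp Xe A f) k := by
  have hV {f : (Fin N → ℝ) → ℝ} (hf : ContDiffOn ℝ ∞ f U) (B : Fin N) :
      ContDiffOn ℝ ∞ (vecFieldOp Xe B f) U := contDiffOn_vecFieldOp hU (hX B) hf
  have hdiff {f : (Fin N → ℝ) → ℝ} (hf : ContDiffOn ℝ ∞ f U) : DifferentiableAt ℝ f k :=
    (hf.contDiffAt (hU.mem_nhds hk)).differentiableAt (by simp)
  have hcas : casimirOp g Xe f = fun x => ∑ p : Fin N × Fin N,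
      g p.1 p.2 * vecFieldOp Xe p.1 (vecFieldOp Xe p.2 f) x := by
    funext x
    rw [Fintype.sum_prod_type]
    rfl
  have hterm (B F : Fin N) : vecFieldOp Xe A (vecFieldOp Xe B (vecFieldOp Xe F f)) k =
      vecFieldOp Xe B (vecFieldOp Xe F (vecFieldOp Xe A f)) k
        + ∑ D, c D A F * vecFieldOp Xe B (vecFieldOp Xe D f) k
        + ∑ D, c D A B * vecFieldOp Xe D (vecFieldOp Xe F f) k := by
    rw [hcomm _ (hV hf F) A B k hk, vecFieldOp_congr hU B (hcomm f hf A F) hk,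
      vecFieldOp_add B (hdiff (hV (hV hf A) F))
        (.fun_sum fun D _ => (hdiff (hV hf D)).const_mul _),
      vecFieldOp_sum B _ fun D => hdiff (hV hf D)]
  rw [hcas, vecFieldOp_sum A (fun p : Fin N × Fin N => g p.1 p.2)
    (f := fun p => vecFieldOp Xe p.1 (vecFieldOp Xe p.2 f))
    fun p => hdiff (hV (hV hf p.2) p.1), Fintype.sum_prod_type]
  simp only [hterm, mul_add, Finset.sum_add_distrib, casimirOp]
  rw [add_assoc, add_eq_left]
  set T : Fin N → Fin N → ℝ := fun B D => vecFieldOp Xe B (vecFieldOp Xe D f) k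
  have h1 : ∑ B, ∑ F, g B F * ∑ D, c D A F * T B D =
      ∑ B, ∑ D, (∑ F, g B F * c D A F) * T B D := by
    simp only [Finset.mul_sum, Finset.sum_mul, ← mul_assoc]
    exact Finset.sum_congr rfl fun B _ => Finset.sum_comm
  have h2 : ∑ F, ∑ D, g F D * ∑ B, c B A F * T B D =
      ∑ B, ∑ D, (∑ F, c B A F * g F D) * T B D := by
    simp only [Finset.mul_sum, Finset.sum_mul]
    rw [Finset.sum_comm]
    conv_rhs => rw [Finset.sum_comm]
    refine Finset.sum_congr rfl fun D _ => ?_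
    rw [Finset.sum_comm]
    exact Finset.sum_congr rfl fun B _ => Finset.sum_congr rfl fun F _ => by ring
  rw [h1, h2, ← Finset.sum_add_distrib]
  refine Finset.sum_eq_zero fun B _ => ?_
  rw [← Finset.sum_add_distrib]
  refine Finset.sum_eq_zero fun D _ => ?_
  rw [← add_mul, add_comm, hg, zero_mul]

end Commutator

section Coframe

open scoped Matrix.Norms.Operator ContDiff

variable {N : ℕ}

/-- Matrices acting on column vectors, as a continuous linear map into the endomorphisms. -/
noncomputable def mulVecCLM :
    Matrix (Fin N) (Fin N) ℝ →L[ℝ] (Fin N → ℝ) →L[ℝ] (Fin N → ℝ) :=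
  LinearMap.toContinuousLinearMap
    (LinearMap.toContinuousLinearMap.toLinearMap ∘ₗ Matrix.toLin'.toLinearMap)

lemma mulVecCLM_apply (M : Matrix (Fin N) (Fin N) ℝ) (v : Fin N → ℝ) :
    mulVecCLM M v = M *ᵥ v := rfl

/-- The linear map `k ↦ Σ_A k^A C_A`. -/
noncomputable def adMatrix (CM : Fin N → Matrix (Fin N) (Fin N) ℝ) :
    (Fin N → ℝ) →L[ℝ] Matrix (Fin N) (Fin N) ℝ :=
  LinearMap.toContinuousLinearMap (Fintype.linearCombination ℝ CM)

lemma adMatrix_apply (CM : Fin N → Matrix (Fin N) (Fin N) ℝ) (k : Fin N → ℝ) :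
    adMatrix CM k = ∑ A, k A • CM A := rfl

/-- The coframe `Y = (1 - exp (-ad)) / ad`. -/
noncomputable def coframe (CM : Fin N → Matrix (Fin N) (Fin N) ℝ) (k : Fin N → ℝ) :
    Matrix (Fin N) (Fin N) ℝ :=
  oneSubExpNegDiv (adMatrix CM k)

lemma contDiff_coframe (CM : Fin N → Matrix (Fin N) (Fin N) ℝ)
    {n : WithTop ℕ∞} : ContDiff ℝ n (coframe CM) :=
  have : CompleteSpace (Matrix (Fin N) (Fin N) ℝ) := FiniteDimensional.complete ℝ _
  contDiff_oneSubExpNegDiv.comp (adMatrix CM).contDiff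

lemma isOpen_setOf_isUnit_coframe (CM : Fin N → Matrix (Fin N) (Fin N) ℝ) :
    IsOpen {k | IsUnit (coframe CM k)} :=
  have : CompleteSpace (Matrix (Fin N) (Fin N) ℝ) := FiniteDimensional.complete ℝ _
  Units.isOpen.preimage (contDiff_coframe CM (n := 0)).continuous

lemma contDiffOn_dualFrame (CM : Fin N → Matrix (Fin N) (Fin N) ℝ) (A : Fin N) :
    ContDiffOn ℝ ∞ (fun k M => (coframe CM k)⁻¹ M A)
      {k | IsUnit (coframe CM k)} := by
  have : CompleteSpace (Matrix (Fin N) (Fin N) ℝ) := FiniteDimensional.complete ℝ _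
  intro k hk
  obtain ⟨u, hu⟩ := hk
  have hinv : ContDiffAt ℝ ∞ Ring.inverse (coframe CM k) :=
    hu ▸ contDiffAt_ringInverse ℝ u
  have h := (hinv.comp k (contDiff_coframe CM).contDiffAt).continuousLinearMap_comp
    (mulVecCLM (N := N))
  refine (ContDiffAt.congr_of_eventuallyEq (h.clm_apply (contDiffAt_const (c := Pi.single A 1)))
    (.of_forall fun x => ?_)).contDiffWithinAt
  funext M
  rw [Matrix.nonsing_inv_eq_ringInverse]
  change _ = (Ring.inverse (coframe CM x) *ᵥ Pi.single A 1) M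
  simp

/-- Structure equation of the frame dual to `(1 - exp (-ad)) / ad`. -/
lemma lieBracket_dualFrame (CM : Fin N → Matrix (Fin N) (Fin N) ℝ)
    (hanti : ∀ A B D, CM A D B = -CM B D A)
    (hcomm : ∀ A B, CM A * CM B - CM B * CM A = ∑ D, CM A D B • CM D)
    {k : Fin N → ℝ} (hk : IsUnit (coframe CM k)) (A B : Fin N) :
    VectorField.lieBracket ℝ (fun k M => (coframe CM k)⁻¹ M A)
      (fun k M => (coframe CM k)⁻¹ M B) k =
    ∑ D, CM A D B • fun M => (coframe CM k)⁻¹ M D := by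
  have : CompleteSpace (Matrix (Fin N) (Fin N) ℝ) := FiniteDimensional.complete ℝ _
  set L := (mulVecCLM (N := N)).comp (adMatrix CM)
  have hLapply (v w : Fin N → ℝ) (D : Fin N) :
      L v w D = ∑ A, ∑ B, v A * CM A D B * w B := by
    change ((∑ A, v A • CM A) *ᵥ w) D = _
    rw [Matrix.sum_mulVec, Finset.sum_apply]
    simp [Matrix.mulVec, dotProduct, mul_assoc]
  have hLanti (v w : Fin N → ℝ) : L v w = -L w v := by
    funext D
    rw [Pi.neg_apply, hLapply, hLapply, Finset.sum_comm, ← Finset.sum_neg_distrib]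
    refine Finset.sum_congr rfl fun B _ => ?_
    rw [← Finset.sum_neg_distrib]
    refine Finset.sum_congr rfl fun A _ => ?_
    rw [hanti A B D]
    ring
  have had (v w : Fin N → ℝ) :
      adMatrix CM (L v w) = adMatrix CM v * adMatrix CM w - adMatrix CM w * adMatrix CM v := by
    have h1 : adMatrix CM v * adMatrix CM w - adMatrix CM w * adMatrix CM v =
        ∑ A, ∑ B, (v A * w B) • (CM A * CM B - CM B * CM A) := by
      simp only [adMatrix_apply, Finset.sum_mul_sum, smul_sub, Finset.sum_sub_distrib,
        smul_mul_smul_comm]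
      congr 1
      rw [Finset.sum_comm]
      simp only [mul_comm]
    rw [h1, adMatrix_apply]
    simp only [hcomm, hLapply, Finset.sum_smul, Finset.smul_sum, smul_smul]
    rw [Finset.sum_comm]
    refine Finset.sum_congr rfl fun A _ => ?_
    rw [Finset.sum_comm]
    refine Finset.sum_congr rfl fun B _ => Finset.sum_congr rfl fun D _ => ?_
    congr 1
    ring
  have hYsmooth : ContDiff ℝ 2 (coframe CM) := contDiff_coframe CM
  have hTY : ContDiff ℝ 2 fun k => mulVecCLM (coframe CM k) := mulVecCLM.contDiff.comp hYsmooth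
  have hrad (k v : Fin N → ℝ) :
      fderiv ℝ (fun k => mulVecCLM (coframe CM k)) k k v + mulVecCLM (coframe CM k) v
      + L k (mulVecCLM (coframe CM k) v) = v := by
    have h0 : HasFDerivAt (coframe CM)
        ((fderiv ℝ oneSubExpNegDiv (adMatrix CM k)).comp (adMatrix CM)) k :=
      ((contDiff_oneSubExpNegDiv (n := 1)).differentiable one_ne_zero
        |>.differentiableAt.hasFDerivAt).comp k (adMatrix CM).hasFDerivAt
    have h1 : HasFDerivAt (fun k => mulVecCLM (coframe CM k))
        (mulVecCLM.comp ((fderiv ℝ oneSubExpNegDiv (adMatrix CM k)).comp (adMatrix CM))) k :=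
      (mulVecCLM.hasFDerivAt (x := coframe CM k)).comp k h0
    have h2 := congrArg (fun M => M *ᵥ v) (fderiv_oneSubExpNegDiv_self (adMatrix CM k))
    rw [h1.fderiv]
    simp only [Matrix.add_mulVec, ← Matrix.mulVec_mulVec, Matrix.one_mulVec] at h2
    exact h2
  have hMC := maurerCartan_of_radial L hLanti (fun v w u => by
    change adMatrix CM (L v w) *ᵥ u =
      adMatrix CM v *ᵥ (adMatrix CM w *ᵥ u) - adMatrix CM w *ᵥ (adMatrix CM v *ᵥ u)
    rw [had, Matrix.sub_mulVec, Matrix.mulVec_mulVec, Matrix.mulVec_mulVec]) _ hTY hrad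
  have hopen := isOpen_setOf_isUnit_coframe CM
  have hdiff (A : Fin N) : DifferentiableAt ℝ (fun k M => (coframe CM k)⁻¹ M A) k :=
    ((contDiffOn_dualFrame CM A).contDiffAt (hopen.mem_nhds hk)).differentiableAt (by simp)
  have hdual {x : Fin N → ℝ} (hx : IsUnit (coframe CM x)) (A : Fin N) :
      coframe CM x *ᵥ (fun M => (coframe CM x)⁻¹ M A) = Pi.single A 1 := by
    rw [show (fun M => (coframe CM x)⁻¹ M A) = (coframe CM x)⁻¹ *ᵥ Pi.single A 1 by ext; simp,
      Matrix.mulVec_mulVec, Matrix.mul_nonsing_inv _ ((Matrix.isUnit_iff_isUnit_det _).mp hx),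
      Matrix.one_mulVec]
  have hdual' (A : Fin N) :
      ∀ᶠ x in nhds k, mulVecCLM (coframe CM x) (fun M => (coframe CM x)⁻¹ M A) = Pi.single A 1 :=
    Filter.eventually_of_mem (hopen.mem_nhds hk) fun x hx => hdual hx A
  have hbr := lieBracket_of_maurerCartan L _ hMC
    (hTY.differentiable two_ne_zero).differentiableAt (hdiff A) (hdiff B) (hdual' A) (hdual' B)
  apply Matrix.mulVec_injective_of_isUnit hk
  refine hbr.trans ?_
  change _ = mulVecCLM (coframe CM k) _
  simp only [map_sum, map_smul, mulVecCLM_apply]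
  funext D
  simp [hLapply, Pi.single_apply, hdual hk]

end Coframe

lemma coframe_eq_tsum {N : ℕ} (CM : Fin N → Matrix (Fin N) (Fin N) ℝ) (k : Fin N → ℝ) :
    coframe CM k =
      ∑' j : ℕ, ((-1 : ℝ) ^ j / (Nat.factorial (j + 1))) • (∑ A, k A • CM A) ^ j := by
  open scoped Matrix.Norms.Operator in
  have : CompleteSpace (Matrix (Fin N) (Fin N) ℝ) := FiniteDimensional.complete ℝ _
  exact oneSubExpNegDiv_eq_tsum (∑ A, k A • CM A)

/-- The Casimir operator `X² = γ^{AB} X_A X_B` commutes with each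
right-invariant vector field `X_A` on `U = {k : Y(k) invertible}`. -/
theorem casimir_commutes_with_XA
    (N : ℕ)
    (C : Fin N → Fin N → Fin N → ℝ)
    (hCanti : ∀ A B C', C A B C' = -C A C' B)
    (CM : Fin N → Matrix (Fin N) (Fin N) ℝ)
    (hCM : ∀ A B C', CM A B C' = C B A C')
    (hCC : ∀ A B, CM A * CM B - CM B * CM A = ∑ C', C C' A B • CM C')
    (γ : Matrix (Fin N) (Fin N) ℝ)
    (hγsymm : γᵀ = γ) (hγinv : IsUnit γ)
    (hγC : ∀ A C' D', ∑ B, (γ A B * C B C' D' + γ D' B * C B C' A) = 0)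
    (Y : (Fin N → ℝ) → Matrix (Fin N) (Fin N) ℝ)
    (hY : ∀ k, Y k =
      ∑' j : ℕ, ((-1 : ℝ) ^ j / (Nat.factorial (j + 1))) • (∑ A, k A • CM A) ^ j)
    (U : Set (Fin N → ℝ))
    (hU : U = {k | IsUnit (Y k)})
    (Xe : (Fin N → ℝ) → Fin N → Fin N → ℝ)
    (hXe : ∀ k A M, Xe k A M = (Y k)⁻¹ M A) :
    ∀ f : (Fin N → ℝ) → ℝ, ContDiffOn ℝ (⊤ : ℕ∞) f U →
      ∀ A, ∀ k ∈ U,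
        vecFieldOp Xe A (casimirOp γ⁻¹ Xe f) k = casimirOp γ⁻¹ Xe (vecFieldOp Xe A f) k := by
  obtain rfl : Y = coframe CM := by
    funext k
    rw [hY, coframe_eq_tsum]
  subst hU
  obtain rfl : Xe = fun k A M => (coframe CM k)⁻¹ M A := by
    funext k A M
    exact hXe k A M
  have hopen := isOpen_setOf_isUnit_coframe CM
  have hsmooth := contDiffOn_dualFrame CM
  intro f hf A k hk
  refine vecFieldOp_casimirOp_comm hopen hsmooth C γ⁻¹ (fun f hf A B k hk => ?_)
    (fun A B D => ?_) hf A hk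
  · have hdiff (A : Fin N) := ((hsmooth A).contDiffAt (hopen.mem_nhds hk)).differentiableAt
      (by simp)
    have h := VectorField.fderiv_apply_lieBracket (hf.contDiffAt (hopen.mem_nhds hk))
      (by rw [minSmoothness_of_isRCLikeNormedField]; exact WithTop.coe_le_coe.mpr le_top)
      (hdiff B) (hdiff A)
    rw [lieBracket_dualFrame CM (fun A B D => by rw [hCM, hCM, hCanti])
      (fun A B => by simpa only [hCM] using hCC A B) hk, map_sum] at h
    rw [← sub_eq_iff_eq_add']
    have hfun (A : Fin N) := funext (vecFieldOp_eq_fderiv (Xe := fun k A M =>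
      (coframe CM k)⁻¹ M A) A f)
    simp only [vecFieldOp_eq_fderiv, hfun]
    rw [← h]
    simp [hCM]
  · have hdet := (Matrix.isUnit_iff_isUnit_det γ).mp hγinv
    have hskew : γ * CM A + (CM A)ᵀ * γ = 0 := by
      ext P Q
      have h := hγC P A Q
      rw [Finset.sum_add_distrib] at h
      simp only [Matrix.add_apply, Matrix.mul_apply, Matrix.transpose_apply, hCM, Matrix.zero_apply]
      rw [← h]
      congr 1
      refine Finset.sum_congr rfl fun F _ => ?_
      rw [← congrFun (congrFun hγsymm Q) F, Matrix.transpose_apply, mul_comm]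
    have hskew' : CM A * γ⁻¹ + γ⁻¹ * (CM A)ᵀ = 0 := by
      have h := congrArg (fun M => γ⁻¹ * M * γ⁻¹) hskew
      simp only [mul_add, add_mul, mul_zero, zero_mul] at h
      rwa [Matrix.nonsing_inv_mul_cancel_left _ _ hdet, ← mul_assoc, mul_assoc _ γ,
        Matrix.mul_nonsing_inv _ hdet, mul_one] at h
    have h := congrFun (congrFun hskew' B) D
    simpa [Matrix.mul_apply, hCM] using h
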